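/- arXiv:0707.0500 — 2 statements merged into one kernel-verified Lean document; each statement's English description precedes it below -/
import Mathlib

section
/- Let P be an n×n row-stochastic matrix with a stationary probability vector π, and suppose there exist an integer τ ≥ 1 and a constant 0 < c < 1 such that the τ-step transition probabilities satisfy Pᵗᵃᵘ(i,j) ≥ (1−c)·π(j) for all states i, j. Then for every probability vector p and every integer t ≥ 0, (1/2)·‖(Pᵗ)ᵀ p − π‖₁ ≤ c^{⌊t/τ⌋}. -/
open Matrix in
/-- Doeblin contraction: a matrix with unit row sums whose rows all dominate `m` contracts the
`ℓ₁` norm of row vectors with zero sum by the factor `1 - ∑ j, m j`. -/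
theorem sum_abs_vecMul_le_of_minorization {ι : Type*} [Fintype ι] {Q : Matrix ι ι ℝ}
    {m v : ι → ℝ} (hQ : ∀ i, ∑ j, Q i j = 1) (hm : ∀ i j, m j ≤ Q i j) (hv : ∑ i, v i = 0) :
    ∑ j, |(v ᵥ* Q) j| ≤ (1 - ∑ j, m j) * ∑ i, |v i| := by
  have key (j : ι) : |(v ᵥ* Q) j| ≤ ∑ i, |v i| * (Q i j - m j) := by
    have h : (v ᵥ* Q) j = ∑ i, v i * (Q i j - m j) := by
      simp [vecMul, dotProduct, mul_sub, Finset.sum_sub_distrib, ← Finset.sum_mul, hv]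
    rw [h]
    refine (Finset.abs_sum_le_sum_abs _ _).trans_eq (Finset.sum_congr rfl fun i _ => ?_)
    rw [abs_mul, abs_of_nonneg (sub_nonneg.2 (hm i j))]
  refine (Finset.sum_le_sum fun j _ => key j).trans_eq ?_
  rw [Finset.sum_comm]
  simp [← Finset.mul_sum, Finset.sum_sub_distrib, hQ, ← Finset.sum_mul, mul_comm]

open Matrix in
theorem sum_vecMul_of_row_sum_eq_one {ι : Type*} [Fintype ι] {Q : Matrix ι ι ℝ}
    (hQ : ∀ i, ∑ j, Q i j = 1) (v : ι → ℝ) : ∑ j, (v ᵥ* Q) j = ∑ i, v i := by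
  simp only [vecMul, dotProduct]
  rw [Finset.sum_comm]
  simp [← Finset.mul_sum, hQ]

open Matrix in
theorem sum_abs_vecMul_pow_le_of_minorization {ι : Type*} [Fintype ι] [DecidableEq ι]
    {Q : Matrix ι ι ℝ} {m v : ι → ℝ} (hQ : ∀ i, ∑ j, Q i j = 1) (hm : ∀ i j, m j ≤ Q i j)
    (hm1 : ∑ j, m j ≤ 1) (hv : ∑ i, v i = 0) (k : ℕ) :
    ∑ j, |(v ᵥ* Q ^ k) j| ≤ (1 - ∑ j, m j) ^ k * ∑ i, |v i| := by
  induction k generalizing v with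
  | zero => simp
  | succ k ih =>
    rw [pow_succ', ← vecMul_vecMul, pow_succ, mul_assoc]
    refine (ih ((sum_vecMul_of_row_sum_eq_one hQ v).trans hv)).trans ?_
    exact mul_le_mul_of_nonneg_left (sum_abs_vecMul_le_of_minorization hQ hm hv)
      (pow_nonneg (sub_nonneg.2 hm1) k)


/-- If the `τ`-step transition probabilities of a row-stochastic
matrix `P` with stationary probability vector `pi` satisfy
`(P^τ) i j ≥ (1−c)·pi j` for some `τ ≥ 1` and `0 < c < 1`, then for every
probability vector `p` and every `t ≥ 0`,
`(1/2)·‖(Pᵗ)ᵀ p − pi‖₁ ≤ c^⌊t/τ⌋`. -/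
theorem stmt1 {n : ℕ} (P : Matrix (Fin n) (Fin n) ℝ) (pi : Fin n → ℝ)
    (hPnn : ∀ i j, 0 ≤ P i j) (hProw : ∀ i, ∑ j, P i j = 1)
    (hpinn : ∀ i, 0 ≤ pi i) (hpisum : ∑ i, pi i = 1)
    (hstat : ∀ j, ∑ i, pi i * P i j = pi j)
    (τ : ℕ) (hτ : 1 ≤ τ) (c : ℝ) (hc0 : 0 < c) (hc1 : c < 1)
    (hminor : ∀ i j, (1 - c) * pi j ≤ (P ^ τ) i j) :
    ∀ p : Fin n → ℝ, (∀ i, 0 ≤ p i) → (∑ i, p i = 1) →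
      ∀ t : ℕ, (1 / 2) * ∑ j, |(∑ i, (P ^ t) i j * p i) - pi j| ≤ c ^ (t / τ) := by
  intro p hp hpsum t
  have hmem : P ∈ Matrix.rowStochastic ℝ (Fin n) :=
    Matrix.mem_rowStochastic_iff_sum.2 ⟨hPnn, hProw⟩
  have hpow (k : ℕ) := Matrix.mem_rowStochastic_iff_sum.1 (pow_mem hmem k)
  have hpi (k : ℕ) : Matrix.vecMul pi (P ^ k) = pi := by
    induction k with
    | zero => simp
    | succ k ih =>
      rw [pow_succ, ← Matrix.vecMul_vecMul, ih]
      exact funext hstat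
  have hd : ∑ i, (p - pi) i = 0 := by simp [Finset.sum_sub_distrib, hpsum, hpisum]
  have hsum : ∑ j, (1 - c) * pi j = 1 - c := by rw [← Finset.mul_sum, hpisum, mul_one]
  have hentry (j : Fin n) :
      (∑ i, (P ^ t) i j * p i) - pi j =
        Matrix.vecMul (Matrix.vecMul (p - pi) ((P ^ τ) ^ (t / τ))) (P ^ (t % τ)) j := by
    rw [Matrix.vecMul_vecMul, ← pow_mul, ← pow_add, Nat.div_add_mod, Matrix.sub_vecMul, hpi]
    simp [Matrix.vecMul, dotProduct, mul_comm]
  have hd' : ∑ i, Matrix.vecMul (p - pi) ((P ^ τ) ^ (t / τ)) i = 0 := by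
    rw [← pow_mul, sum_vecMul_of_row_sum_eq_one (hpow _).2, hd]
  have hrem := sum_abs_vecMul_le_of_minorization (m := 0) (hpow (t % τ)).2 (hpow (t % τ)).1 hd'
  have hmain := sum_abs_vecMul_pow_le_of_minorization (hpow τ).2 hminor
    (by linarith) hd (t / τ)
  have htwo : ∑ i, |(p - pi) i| ≤ 2 := by
    calc ∑ i, |(p - pi) i| ≤ ∑ i, (p i + pi i) := Finset.sum_le_sum fun i _ =>
          abs_le.2 ⟨by simp only [Pi.sub_apply]; linarith [hp i],
            by simp only [Pi.sub_apply]; linarith [hpinn i]⟩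
      _ = 2 := by rw [Finset.sum_add_distrib, hpsum, hpisum]; norm_num
  simp only [Pi.zero_apply, Finset.sum_const_zero, sub_zero, one_mul] at hrem
  rw [hsum, sub_sub_cancel] at hmain
  simp only [hentry]
  have := mul_le_mul_of_nonneg_left htwo (pow_nonneg hc0.le (t / τ))
  linarith
end

section
/- For every integer k ≥ 2, every state s₀ of the grid chain, and every integer t with 0 ≤ t ≤ k, the ℓ₁ distance of the t-step distribution from uniform satisfies ∑_{s ∈ S} |P̃ᵗ(s₀, s) − 1/(4k²)| ≥ 3/16. Hence the ε-mixing time of the grid chain is greater than k whenever 0 < ε < 3/32. -/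
/-- One move of the grid random walk on the `k × k` grid: from position `(x, y)`
heading in direction `d` (`0 = E`, `1 = N`, `2 = W`, `3 = S`), move one step in
direction `d`, bouncing back (reversing direction while staying at the same node)
at the boundary. -/
def gridMove {k : ℕ} (x y : Fin k) (d : Fin 4) : Fin k × Fin k × Fin 4 :=
  if d = 0 then
    if h : (x : ℕ) + 1 < k then (⟨(x : ℕ) + 1, h⟩, y, 0) else (x, y, 2)
  else if d = 1 then
    if h : (y : ℕ) + 1 < k then (x, ⟨(y : ℕ) + 1, h⟩, 1) else (x, y, 3)
  else if d = 2 then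
    if 0 < (x : ℕ) then (⟨(x : ℕ) - 1, lt_of_le_of_lt (Nat.sub_le _ _) x.isLt⟩, y, 2)
    else (x, y, 0)
  else
    if 0 < (y : ℕ) then (x, ⟨(y : ℕ) - 1, lt_of_le_of_lt (Nat.sub_le _ _) y.isLt⟩, 3)
    else (x, y, 1)

/-- The nonreversible grid chain `P̃` on the state space
`{0,…,k−1} × {0,…,k−1} × {E,N,W,S}`: with probability `1 − 1/k` keep the current
direction (bouncing at the boundary), and with probability `1/(2k)` each make a
90-degree turn to either side, moving one step in the turned direction (a turn
toward a nonexistent neighbor being redirected to the corresponding state of the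
current node). -/
noncomputable def gridChain (k : ℕ) :
    Matrix (Fin k × Fin k × Fin 4) (Fin k × Fin k × Fin 4) ℝ := fun s s' =>
  (1 - 1 / (k : ℝ)) * (if gridMove s.1 s.2.1 s.2.2 = s' then 1 else 0)
    + (1 / (2 * (k : ℝ))) * (if gridMove s.1 s.2.1 (s.2.2 + 1) = s' then 1 else 0)
    + (1 / (2 * (k : ℝ))) * (if gridMove s.1 s.2.1 (s.2.2 + 3) = s' then 1 else 0)

theorem gridChain_nonneg {k : ℕ} (hk : 2 ≤ k) (s s' : Fin k × Fin k × Fin 4) :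
    0 ≤ gridChain k s s' := by
  have hk' : (2 : ℝ) ≤ k := by exact_mod_cast hk
  have h1 : 0 ≤ 1 - 1 / (k : ℝ) := by
    rw [sub_nonneg, div_le_one (by linarith)]
    linarith
  unfold gridChain
  positivity

theorem gridChain_straight_ge {k : ℕ} (s : Fin k × Fin k × Fin 4) :
    1 - 1 / (k : ℝ) ≤ gridChain k s (gridMove s.1 s.2.1 s.2.2) := by
  simp only [gridChain, if_true, mul_one]
  have h2 : ∀ p : Prop, ∀ [Decidable p],
      0 ≤ (1 / (2 * (k : ℝ))) * (if p then 1 else 0 : ℝ) := fun p _ => by positivity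
  have := h2 (gridMove s.1 s.2.1 (s.2.2 + 1) = gridMove s.1 s.2.1 s.2.2)
  have := h2 (gridMove s.1 s.2.1 (s.2.2 + 3) = gridMove s.1 s.2.1 s.2.2)
  linarith

/-- After `t` steps, some state (the one reached without turning) carries mass at least
`(1 - 1 / k) ^ t`. -/
theorem exists_pow_le_gridChain_pow {k : ℕ} (hk : 2 ≤ k) (s₀ : Fin k × Fin k × Fin 4) (t : ℕ) :
    ∃ s, (1 - 1 / (k : ℝ)) ^ t ≤ (gridChain k ^ t) s₀ s := by
  have hk' : (2 : ℝ) ≤ k := by exact_mod_cast hk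
  have h1 : 0 ≤ 1 - 1 / (k : ℝ) := by
    rw [sub_nonneg, div_le_one (by linarith)]
    linarith
  have hnn : ∀ (n : ℕ) (s s' : Fin k × Fin k × Fin 4), 0 ≤ (gridChain k ^ n) s s' := by
    intro n
    induction n with
    | zero => intro s s'; rw [pow_zero, Matrix.one_apply]; positivity
    | succ n ih =>
      intro s s'
      rw [pow_succ, Matrix.mul_apply]
      exact Finset.sum_nonneg fun r _ => mul_nonneg (ih s r) (gridChain_nonneg hk r s')
  induction t with
  | zero => exact ⟨s₀, by simp⟩
  | succ t ih =>
    obtain ⟨s, hs⟩ := ih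
    refine ⟨gridMove s.1 s.2.1 s.2.2, ?_⟩
    rw [pow_succ, pow_succ, Matrix.mul_apply]
    refine (mul_le_mul hs (gridChain_straight_ge s) h1 (hnn t s₀ s)).trans ?_
    exact Finset.single_le_sum
      (f := fun r => (gridChain k ^ t) s₀ r * gridChain k r (gridMove s.1 s.2.1 s.2.2))
      (fun r _ => mul_nonneg (hnn t s₀ r) (gridChain_nonneg hk r _)) (Finset.mem_univ s)

theorem one_fourth_le_one_sub_one_div_pow {k : ℕ} (hk : 2 ≤ k) :
    1 / 4 ≤ (1 - 1 / (k : ℝ)) ^ k := by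
  have hk' : (2 : ℝ) ≤ k := by exact_mod_cast hk
  have hinv : 1 / (k : ℝ) ≤ 1 := by
    rw [div_le_one (by linarith)]
    linarith
  have hb := one_add_mul_self_le_rpow_one_add (s := -(1 / (k : ℝ))) (by linarith)
    (p := (k : ℝ) / 2) (by linarith)
  have he : 1 + (k : ℝ) / 2 * -(1 / (k : ℝ)) = 1 / 2 := by
    field_simp
    norm_num
  rw [he, ← sub_eq_add_neg] at hb
  have hsq : ((1 - 1 / (k : ℝ)) ^ ((k : ℝ) / 2)) ^ 2 = (1 - 1 / (k : ℝ)) ^ k := by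
    rw [← Real.rpow_natCast, ← Real.rpow_mul (by linarith), ← Real.rpow_natCast]
    congr 1
    push_cast
    ring
  rw [← hsq]
  nlinarith

/-- For every `k ≥ 2`, every starting state `s₀` of the grid chain, and
every `0 ≤ t ≤ k`, the ℓ₁ distance of the `t`-step distribution from uniform is at least
`3/16`; hence the `ε`-mixing time of the grid chain is greater than `k` whenever
`0 < ε < 3/32`. -/
theorem stmt7 (k : ℕ) (hk : 2 ≤ k) (s₀ : Fin k × Fin k × Fin 4) (t : ℕ) (ht : t ≤ k) :
    3 / 16 ≤ ∑ s, |(gridChain k ^ t) s₀ s - 1 / (4 * (k : ℝ) ^ 2)| ∧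
    ∀ ε : ℝ, 0 < ε → ε < 3 / 32 →
      ε < (1 / 2) * ∑ s, |(gridChain k ^ t) s₀ s - 1 / (4 * (k : ℝ) ^ 2)| := by
  have hk' : (2 : ℝ) ≤ k := by exact_mod_cast hk
  have hinv : 1 / (k : ℝ) ≤ 1 := by
    rw [div_le_one (by linarith)]
    linarith
  have hmain : 3 / 16 ≤ ∑ s, |(gridChain k ^ t) s₀ s - 1 / (4 * (k : ℝ) ^ 2)| := by
    obtain ⟨s, hs⟩ := exists_pow_le_gridChain_pow hk s₀ t
    have hpow : (1 - 1 / (k : ℝ)) ^ k ≤ (1 - 1 / (k : ℝ)) ^ t :=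
      pow_le_pow_of_le_one (by linarith) (by linarith [show 0 ≤ 1 / (k : ℝ) by positivity]) ht
    have hunif : 1 / (4 * (k : ℝ) ^ 2) ≤ 1 / 16 :=
      one_div_le_one_div_of_le (by norm_num) (by nlinarith)
    calc (3 / 16 : ℝ) ≤ (gridChain k ^ t) s₀ s - 1 / (4 * (k : ℝ) ^ 2) := by
          linarith [one_fourth_le_one_sub_one_div_pow hk]
      _ ≤ |(gridChain k ^ t) s₀ s - 1 / (4 * (k : ℝ) ^ 2)| := le_abs_self _
      _ ≤ _ := Finset.single_le_sum
          (f := fun s => |(gridChain k ^ t) s₀ s - 1 / (4 * (k : ℝ) ^ 2)|)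
          (fun _ _ => abs_nonneg _) (Finset.mem_univ s)
  exact ⟨hmain, fun ε _ hε => by linarith⟩
end
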